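/- Let E be a union-disjoint factorised representation over a finite schema S containing an attribute A. The recursively defined function sum_A — sum_A(⟨A:a⟩) = a; sum_A(E₁ ∪ ⋯ ∪ Eₙ) = ∑ᵢ sum_A(Eᵢ); sum_A(∅) = 0; and sum_A(E₁ × ⋯ × Eₙ) = sum_A(E_j) · ∏_{i≠j} count(Eᵢ), where E_j is the unique factor whose schema contains A and count(Eᵢ) = |⟦Eᵢ⟧| — computes the sum of the A-values of the represented relation: sum_A(E) = ∑_{t ∈ ⟦E⟧} t(A). -/

import Mathlib

open scoped Classical

noncomputable section

/-- Attributes: a countable set, modelled as the natural numbers. -/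
abbrev Attr := ℕ

/-- A tuple over a finite schema `S` is modelled as a total function `Attr → ℝ`
that vanishes outside `S`. -/
abbrev Tuple := Attr → ℝ

/-- `t` is a tuple over the schema `S`: it vanishes outside `S`. -/
def IsOverSchema (t : Tuple) (S : Finset Attr) : Prop := ∀ A ∉ S, t A = 0

/-- Factorised representations over a finite schema. -/
inductive FRep : Finset Attr → Type
  | sing (A : Attr) (a : ℝ) : FRep {A}
  | unit : FRep ∅
  | empty (S : Finset Attr) : FRep S
  | union {S : Finset Attr} (E₁ E₂ : FRep S) : FRep S
  | prod {S₁ S₂ : Finset Attr} (h : Disjoint S₁ S₂) (E₁ : FRep S₁) (E₂ : FRep S₂) :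
      FRep (S₁ ∪ S₂)

namespace FRep

/-- The represented relation `⟦E⟧`. -/
def rel : {S : Finset Attr} → FRep S → Finset Tuple
  | _, sing A a => {fun B => if B = A then a else 0}
  | _, unit => {fun _ => 0}
  | _, empty _ => ∅
  | _, union E₁ E₂ => rel E₁ ∪ rel E₂
  | _, prod _ E₁ E₂ => (rel E₁ ×ˢ rel E₂).image fun p => p.1 + p.2

/-- `E` is union-disjoint: in every union subexpression of `E`, the represented
relations of the components are pairwise disjoint. -/
def UnionDisjoint : {S : Finset Attr} → FRep S → Prop
  | _, sing _ _ => True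
  | _, unit => True
  | _, empty _ => True
  | _, union E₁ E₂ => Disjoint (rel E₁) (rel E₂) ∧ UnionDisjoint E₁ ∧ UnionDisjoint E₂
  | _, prod _ E₁ E₂ => UnionDisjoint E₁ ∧ UnionDisjoint E₂

/-- The recursively defined function `sum_A`:
`sum_A ⟨A:a⟩ = a`, `sum_A (E₁ ∪ E₂) = sum_A E₁ + sum_A E₂`, `sum_A ∅ = 0`, and
`sum_A (E₁ × E₂) = sum_A E_j · ∏_{i ≠ j} count Eᵢ` where `E_j` is the unique
factor whose schema contains `A` and `count Eᵢ = |⟦Eᵢ⟧|`. -/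
def sumA (A : Attr) : {S : Finset Attr} → FRep S → ℝ
  | _, sing _ a => a
  | _, unit => 0
  | _, empty _ => 0
  | _, union E₁ E₂ => sumA A E₁ + sumA A E₂
  | _, @prod S₁ _ _ E₁ E₂ =>
      if A ∈ S₁ then sumA A E₁ * ((rel E₂).card : ℝ)
      else ((rel E₁).card : ℝ) * sumA A E₂

end FRep

theorem FRep.rel_over {S : Finset Attr} (E : FRep S) :
    ∀ t ∈ E.rel, ∀ B, B ∉ S → t B = 0 := by
  induction E with
  | sing A a =>
    intro t ht B hB
    simp only [FRep.rel, Finset.mem_singleton] at ht hB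
    subst ht
    simp [hB]
  | unit =>
    intro t ht B hB
    simp only [FRep.rel, Finset.mem_singleton] at ht
    subst ht
    rfl
  | empty S =>
    intro t ht
    simp [FRep.rel] at ht
  | union E₁ E₂ ih₁ ih₂ =>
    intro t ht B hB
    simp only [FRep.rel, Finset.mem_union] at ht
    rcases ht with ht | ht
    · exact ih₁ t ht B hB
    · exact ih₂ t ht B hB
  | prod h E₁ E₂ ih₁ ih₂ =>
    intro t ht B hB
    simp only [FRep.rel, Finset.mem_image, Finset.mem_product] at ht
    obtain ⟨⟨u, v⟩, ⟨hu, hv⟩, rfl⟩ := ht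
    simp only [Finset.mem_union, not_or] at hB
    simp [ih₁ u hu B hB.1, ih₂ v hv B hB.2]

theorem FRep.prod_injOn {S₁ S₂ : Finset Attr} (h : Disjoint S₁ S₂)
    (E₁ : FRep S₁) (E₂ : FRep S₂) :
    ∀ p ∈ E₁.rel ×ˢ E₂.rel, ∀ q ∈ E₁.rel ×ˢ E₂.rel, p.1 + p.2 = q.1 + q.2 → p = q := by
  rintro ⟨u, v⟩ hp ⟨u', v'⟩ hq hpq
  simp only [Finset.mem_product] at hp hq hpq
  have key : ∀ B, u B = u' B ∧ v B = v' B := by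
    intro B
    have e : u B + v B = u' B + v' B := congrFun hpq B
    by_cases hB : B ∈ S₁
    · have hB2 : B ∉ S₂ := Finset.disjoint_left.mp h hB
      have h1 := E₂.rel_over v hp.2 B hB2
      have h2 := E₂.rel_over v' hq.2 B hB2
      constructor <;> linarith
    · have h1 := E₁.rel_over u hp.1 B hB
      have h2 := E₁.rel_over u' hq.1 B hB
      constructor <;> linarith
  exact Prod.ext (funext fun B => (key B).1) (funext fun B => (key B).2)

/-- For every union-disjoint factorised representation `E` over a finite schema `S`
containing the attribute `A`, the recursively defined function `sum_A` computes the
sum of the `A`-values of the represented relation: `sum_A E = ∑_{t ∈ ⟦E⟧} t(A)`. -/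
theorem sumA_correct {S : Finset Attr} (A : Attr) (E : FRep S)
    (hA : A ∈ S) (hE : E.UnionDisjoint) :
    E.sumA A = ∑ t ∈ E.rel, t A := by
  induction E with
  | sing B a =>
    have hAB : A = B := by simpa using hA
    simp [FRep.sumA, FRep.rel, hAB]
  | unit => simp at hA
  | empty S => simp [FRep.sumA, FRep.rel]
  | union E₁ E₂ ih₁ ih₂ =>
    obtain ⟨hd, h1, h2⟩ := hE
    simp only [FRep.sumA, FRep.rel]
    rw [Finset.sum_union hd, ih₁ hA h1, ih₂ hA h2]
  | @prod S₁ S₂ h E₁ E₂ ih₁ ih₂ =>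
    obtain ⟨h1, h2⟩ := hE
    simp only [FRep.sumA, FRep.rel]
    rw [Finset.sum_image (FRep.prod_injOn h E₁ E₂), Finset.sum_product]
    by_cases hB : A ∈ S₁
    · have hB2 : A ∉ S₂ := Finset.disjoint_left.mp h hB
      rw [if_pos hB, ih₁ hB h1, Finset.sum_mul]
      refine Finset.sum_congr rfl fun u hu => ?_
      rw [Finset.sum_congr rfl (g := fun _ => u A) fun v hv => by
        simp [E₂.rel_over v hv A hB2]]
      simp [mul_comm]
    · have hA2 : A ∈ S₂ := (Finset.mem_union.mp hA).resolve_left hB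
      rw [if_neg hB, ih₂ hA2 h2]
      rw [Finset.sum_congr rfl (g := fun _ => ∑ v ∈ E₂.rel, v A) fun u hu =>
        Finset.sum_congr rfl fun v hv => by simp [E₁.rel_over u hu A hB]]
      simp

end
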